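/- arXiv:2504.08435 — 2 statements merged into one kernel-verified Lean document; each statement's English description precedes it below -/
import Mathlib

section
/- Let Z ~ N_d(0, Σ) with Σ_{jj} ≥ σ̲² > 0 for all j = 1, ..., d, where d ≥ 1. Then for all real δ₁, δ₂ and all a, b ∈ (ℝ ∪ {±∞})^d, with δ̄ = max(|δ₁|, |δ₂|): P(Z ∈ [a + δ₁, b + δ₂]) ≤ P(Z ∈ [a, b]) + (δ̄/σ̲)(√(2 log d) + 4), where [u,v] denotes the hyperrectangle {x : u_j ≤ x_j ≤ v_j for all j}. -/
open MeasureTheory ProbabilityTheory Real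
open scoped ENNReal

/-- Mills-ratio type lower bound for the Gaussian tail. -/
lemma mills_aux (m s L : ℝ) (hL : 0 ≤ L) (hs : s - m ≤ L) :
    gaussianPDF m 1 s ≤ ENNReal.ofReal (L + 1) * ∫⁻ u in Set.Ioi s, gaussianPDF m 1 u := by
  set h : ℝ → ℝ := fun x => -(rexp (-(L * (x - s)) - (x - s) ^ 2 / 2) / (L + 1 + (x - s))) with hh
  set h' : ℝ → ℝ := fun x => rexp (-(L * (x - s)) - (x - s) ^ 2 / 2) *
    (((L + (x - s)) * (L + 1 + (x - s)) + 1) / (L + 1 + (x - s)) ^ 2) with hh'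
  have hder : ∀ x ∈ Set.Ici s, HasDerivAt h (h' x) x := by
    intro x hx
    have hx' : 0 ≤ x - s := sub_nonneg.2 hx
    have hD : L + 1 + (x - s) ≠ 0 := by positivity
    have h1 : HasDerivAt (fun x : ℝ => x - s) 1 x := (hasDerivAt_id x).sub_const s
    have h2 : HasDerivAt (fun x : ℝ => -(L * (x - s)) - (x - s) ^ 2 / 2)
        (-(L * 1) - (2 * (x - s) ^ 1 * 1) / 2) x := by
      exact ((h1.const_mul L).neg.sub ((h1.pow 2).div_const 2)).congr_deriv (by simp)
    have h3 := (h2.exp.div (h1.const_add (L + 1)) hD).neg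
    refine h3.congr_deriv ?_
    simp only [hh']
    field_simp
    ring
  have hnn : ∀ x ∈ Set.Ioi s, 0 ≤ h' x := by
    intro x hx
    have hx' : 0 ≤ x - s := sub_nonneg.2 (le_of_lt hx)
    simp only [hh']
    positivity
  have hlim : Filter.Tendsto h Filter.atTop (nhds 0) := by
    have hb : Filter.Tendsto (fun x : ℝ => -(1 / (L + 1 + (x - s)))) Filter.atTop (nhds 0) := by
      have : Filter.Tendsto (fun x : ℝ => L + 1 + (x - s)) Filter.atTop Filter.atTop :=
        Filter.tendsto_atTop_add_const_left _ _ (Filter.tendsto_atTop_add_const_right _ _ Filter.tendsto_id)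
      simpa using this.inv_tendsto_atTop.neg
    refine tendsto_of_tendsto_of_tendsto_of_le_of_le' hb tendsto_const_nhds ?_ ?_
    · filter_upwards [Filter.eventually_ge_atTop s] with x hx
      have hx' : 0 ≤ x - s := sub_nonneg.2 hx
      simp only [hh]
      gcongr
      apply Real.exp_le_one_iff.2
      have := mul_nonneg hL hx'
      nlinarith [sq_nonneg (x - s)]
    · filter_upwards [Filter.eventually_ge_atTop s] with x hx
      have hx' : 0 ≤ x - s := sub_nonneg.2 hx
      simp only [hh]
      rw [neg_nonpos]
      positivity
  have hint : IntegrableOn h' (Set.Ioi s) := integrableOn_Ioi_deriv_of_nonneg' hder hnn hlim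
  have hval : ∫ x in Set.Ioi s, h' x = 1 / (L + 1) := by
    rw [integral_Ioi_of_hasDerivAt_of_tendsto' hder hint hlim]
    simp [hh]
  have hle : ∀ x ∈ Set.Ioi s, gaussianPDFReal m 1 s * h' x ≤ gaussianPDFReal m 1 x := by
    intro x hx
    have hx' : 0 ≤ x - s := sub_nonneg.2 (le_of_lt hx)
    have hfrac : ((L + (x - s)) * (L + 1 + (x - s)) + 1) / (L + 1 + (x - s)) ^ 2 ≤ 1 := by
      rw [div_le_one (by positivity)]
      nlinarith
    have h1 : h' x ≤ rexp (-(L * (x - s)) - (x - s) ^ 2 / 2) := by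
      simp only [hh']
      exact mul_le_of_le_one_right (Real.exp_pos _).le hfrac
    calc gaussianPDFReal m 1 s * h' x
        ≤ gaussianPDFReal m 1 s * rexp (-(L * (x - s)) - (x - s) ^ 2 / 2) := by
          gcongr
          exact gaussianPDFReal_nonneg _ _ _
      _ ≤ gaussianPDFReal m 1 x := by
          simp only [gaussianPDFReal]
          rw [mul_assoc, ← Real.exp_add]
          gcongr
          simp only [NNReal.coe_one]
          have := mul_le_mul_of_nonneg_right hs hx'
          nlinarith
  have hkey : gaussianPDFReal m 1 s ≤ (L + 1) * ∫ x in Set.Ioi s, gaussianPDFReal m 1 x := by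
    have h1 : ∫ x in Set.Ioi s, gaussianPDFReal m 1 s * h' x ≤
        ∫ x in Set.Ioi s, gaussianPDFReal m 1 x :=
      setIntegral_mono_on (hint.const_mul _) (integrable_gaussianPDFReal m 1).integrableOn
        measurableSet_Ioi hle
    rw [integral_const_mul, hval] at h1
    have : (0:ℝ) < L + 1 := by positivity
    calc gaussianPDFReal m 1 s = (L + 1) * (gaussianPDFReal m 1 s * (1 / (L + 1))) := by
          field_simp
      _ ≤ _ := by gcongr
  have h2 : ∫⁻ u in Set.Ioi s, gaussianPDF m 1 u =
      ENNReal.ofReal (∫ x in Set.Ioi s, gaussianPDFReal m 1 x) := by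
    rw [← gaussianReal_apply _ one_ne_zero, gaussianReal_apply_eq_integral _ one_ne_zero]
  rw [h2, ← ENNReal.ofReal_mul (by positivity)]
  exact ENNReal.ofReal_le_ofReal hkey

/-- Disintegration along the `j`-th coordinate. -/
lemma slice_aux {Ω : Type*} [MeasurableSpace Ω] (P : Measure Ω) [IsProbabilityMeasure P]
    {ι : Type*} [Fintype ι] [LinearOrder ι] (U : ι → Ω → ℝ) (hU : ∀ i, Measurable (U i))
    (hG : HasGaussianLaw (fun ω i => U i ω) P) (m : ι → ℝ)
    (hm : ∀ i, P.map (U i) = gaussianReal (m i) 1) (j : ι) :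
    ∃ G : ℝ → ℝ≥0∞, Monotone G ∧ (∀ s, G s ≤ 1) ∧ ∀ B : Set ℝ, MeasurableSet B →
      P {ω | U j ω ∈ B ∧ ∀ k, (k < j → U k ω < U j ω) ∧ (j < k → U k ω ≤ U j ω)} =
        ∫⁻ s in B, gaussianPDF (m j) 1 s * G s := by
  have hvar : ∀ i, Var[U i; P] = 1 := by
    intro i
    have := variance_id_gaussianReal (μ := m i) (v := 1)
    rw [← hm i, variance_map (by fun_prop) (hU i).aemeasurable] at this
    simpa using this
  have hL2 : ∀ i, MemLp (U i) 2 P := fun i => (hG.eval i).memLp_two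
  set c : ι → ℝ := fun k => cov[U k, U j; P] with hc
  have hc1 : ∀ k, c k ≤ 1 := by
    intro k
    have h0 := variance_nonneg (U k - U j) P
    rw [variance_sub (hL2 k) (hL2 j), hvar, hvar] at h0
    simp only [hc]; linarith
  set V : ι → Ω → ℝ := fun k ω => U k ω - c k * U j ω with hV
  have hVm : ∀ k, Measurable (V k) := fun k => (hU k).sub ((hU j).const_mul _)
  have hind : IndepFun (fun ω (_ : Unit) => U j ω) (fun ω k => V k ω) P := by
    refine HasGaussianLaw.indepFun_of_covariance_eval (X := fun _ => U j) (Y := V) ?_ ?_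
    · let T : (ι → ℝ) →L[ℝ] ((Unit → ℝ) × (ι → ℝ)) :=
        (ContinuousLinearMap.pi (fun _ => ContinuousLinearMap.proj j)).prod
          (ContinuousLinearMap.pi (fun k => ContinuousLinearMap.proj k -
            c k • ContinuousLinearMap.proj j))
      exact hG.map_fun T
    · intro _ k
      simp only [hV]
      rw [covariance_fun_sub_right (hL2 j) (hL2 k) ((hL2 j).const_mul _),
        covariance_const_mul_right, covariance_self (hU j).aemeasurable, hvar, covariance_comm]
      simp [hc]
  have hind2 : IndepFun (U j) (fun ω k => V k ω) P :=
    hind.comp (φ := fun f : Unit → ℝ => f ()) (ψ := id) (measurable_pi_apply _) measurable_id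
  have hVm' : Measurable (fun ω k => V k ω) := measurable_pi_lambda _ hVm
  set ν := P.map (fun ω k => V k ω) with hν
  have : IsProbabilityMeasure ν := Measure.isProbabilityMeasure_map hVm'.aemeasurable
  have hprod := (indepFun_iff_map_prod_eq_prod_map_map (hU j).aemeasurable hVm'.aemeasurable).1 hind2
  set A : ℝ → Set (ι → ℝ) := fun s => {v | ∀ k, (k < j → v k < (1 - c k) * s) ∧
    (j < k → v k ≤ (1 - c k) * s)} with hA
  refine ⟨fun s => ν (A s), ?_, fun s => prob_le_one, ?_⟩
  · intro s t hst
    apply measure_mono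
    intro v hv k
    have : (1 - c k) * s ≤ (1 - c k) * t :=
      mul_le_mul_of_nonneg_left hst (by linarith [hc1 k])
    exact ⟨fun h => ((hv k).1 h).trans_le this, fun h => ((hv k).2 h).trans this⟩
  · intro B hB
    set E : Set (ℝ × (ι → ℝ)) := {p | p.1 ∈ B ∧ ∀ k, (k < j → p.2 k < (1 - c k) * p.1) ∧
      (j < k → p.2 k ≤ (1 - c k) * p.1)} with hE
    have hEm : MeasurableSet E := by
      refine (measurable_fst hB).inter (s₂ := {p : ℝ × (ι → ℝ) | ∀ k, (k < j → p.2 k < (1 - c k) * p.1) ∧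
          (j < k → p.2 k ≤ (1 - c k) * p.1)}) ?_
      have : {p : ℝ × (ι → ℝ) | ∀ k, (k < j → p.2 k < (1 - c k) * p.1) ∧
          (j < k → p.2 k ≤ (1 - c k) * p.1)} = ⋂ k, ({p | k < j → p.2 k < (1 - c k) * p.1} ∩
          {p | j < k → p.2 k ≤ (1 - c k) * p.1}) := by
        ext p; simp
      rw [this]
      refine MeasurableSet.iInter fun k => MeasurableSet.inter ?_ ?_
      · by_cases h : k < j
        · simp only [h, true_imp_iff]
          exact measurableSet_lt (by fun_prop) (by fun_prop)
        · simp [h]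
      · by_cases h : j < k
        · simp only [h, true_imp_iff]
          exact measurableSet_le (by fun_prop) (by fun_prop)
        · simp [h]
    have h1 : {ω | U j ω ∈ B ∧ ∀ k, (k < j → U k ω < U j ω) ∧ (j < k → U k ω ≤ U j ω)} =
        (fun ω => (U j ω, fun k => V k ω)) ⁻¹' E := by
      ext ω
      simp only [hE, hV, Set.mem_ofPred_eq, Set.mem_preimage]
      refine and_congr_right fun _ => forall_congr' fun k => and_congr ?_ ?_
      · refine imp_congr_right fun _ => ⟨fun h => by linarith, fun h => by linarith⟩
      · refine imp_congr_right fun _ => ⟨fun h => by linarith, fun h => by linarith⟩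
    have h2 : ∀ s, ν (Prod.mk s ⁻¹' E) = B.indicator (fun s => ν (A s)) s := by
      intro s
      by_cases h : s ∈ B
      · rw [Set.indicator_of_mem h]
        congr 1
        ext v; simp [hE, hA, h]
      · rw [Set.indicator_of_notMem h]
        convert measure_empty (μ := ν)
        ext v; simp [hE, h]
    have hmeas : Measurable (fun s => ν (Prod.mk s ⁻¹' E)) := measurable_measure_prodMk_left hEm
    rw [h1, ← Measure.map_apply ((hU j).prodMk hVm') hEm, hprod, Measure.prod_apply hEm, hm,
      gaussianReal_of_var_ne_zero _ one_ne_zero,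
      lintegral_withDensity_eq_lintegral_mul _ (measurable_gaussianPDF _ _) hmeas,
      ← lintegral_indicator hB]
    refine lintegral_congr fun s => ?_
    simp only [Pi.mul_apply, h2]
    by_cases h : s ∈ B <;> simp [h]

/-- Nazarov inequality, for standardised coordinates. -/
lemma nazarov_aux {Ω : Type*} [MeasurableSpace Ω] (P : Measure Ω) [IsProbabilityMeasure P]
    {ι : Type*} [Fintype ι] [LinearOrder ι] (U : ι → Ω → ℝ) (hU : ∀ i, Measurable (U i))
    (hG : HasGaussianLaw (fun ω i => U i ω) P) (m : ι → ℝ)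
    (hm : ∀ i, P.map (U i) = gaussianReal (m i) 1) (L δ : ℝ) (hL : 0 ≤ L)
    (hcard : (Fintype.card ι : ℝ) * rexp (-L ^ 2 / 2) ≤ 1) :
    P {ω | ∀ i, U i ω ≤ δ} ≤ P {ω | ∀ i, U i ω ≤ 0} + ENNReal.ofReal ((L + 2) * δ) := by
  choose G hGmono hG1 hGint using slice_aux P U hU hG m hm
  set J : ι → Set ℝ → Set Ω := fun j B =>
    {ω | U j ω ∈ B ∧ ∀ k, (k < j → U k ω < U j ω) ∧ (j < k → U k ω ≤ U j ω)} with hJ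
  have hJm : ∀ j B, MeasurableSet B → MeasurableSet (J j B) := by
    intro j B hB
    refine (hU j hB).inter (s₂ := {ω | ∀ k, (k < j → U k ω < U j ω) ∧ (j < k → U k ω ≤ U j ω)}) ?_
    have : {ω | ∀ k, (k < j → U k ω < U j ω) ∧ (j < k → U k ω ≤ U j ω)} =
        ⋂ k, ({ω | k < j → U k ω < U j ω} ∩ {ω | j < k → U k ω ≤ U j ω}) := by
      ext p; simp
    rw [this]
    refine MeasurableSet.iInter fun k => MeasurableSet.inter ?_ ?_
    · by_cases h : k < j
      · simp only [h, true_imp_iff]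
        exact measurableSet_lt (hU k) (hU j)
      · simp [h]
    · by_cases h : j < k
      · simp only [h, true_imp_iff]
        exact measurableSet_le (hU k) (hU j)
      · simp [h]
  have hpt : ∀ s, ∑ j, gaussianPDF (m j) 1 s * G j s ≤ ENNReal.ofReal (L + 2) := by
    intro s
    have hterm : ∀ j, gaussianPDF (m j) 1 s * G j s ≤
        ENNReal.ofReal (L + 1) * P (J j (Set.Ioi s)) + ENNReal.ofReal (rexp (-L ^ 2 / 2)) := by
      intro j
      rcases le_or_gt (s - m j) L with h | h
      · refine le_add_right ?_
        rw [hGint j _ measurableSet_Ioi]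
        calc gaussianPDF (m j) 1 s * G j s
            ≤ (ENNReal.ofReal (L + 1) * ∫⁻ u in Set.Ioi s, gaussianPDF (m j) 1 u) * G j s := by
              gcongr; exact mills_aux _ _ _ hL h
          _ = ENNReal.ofReal (L + 1) * ∫⁻ u in Set.Ioi s, gaussianPDF (m j) 1 u * G j s := by
              rw [lintegral_mul_const _ (measurable_gaussianPDF _ _), mul_assoc]
          _ ≤ _ := by
              refine mul_le_mul_right ?_ _
              refine setLIntegral_mono' measurableSet_Ioi fun u hu => ?_
              gcongr
              exact hGmono j (le_of_lt hu)
      · refine le_add_left ?_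
        calc gaussianPDF (m j) 1 s * G j s ≤ gaussianPDF (m j) 1 s * 1 := by
              gcongr; exact hG1 j s
          _ ≤ _ := by
              rw [mul_one, gaussianPDF]
              apply ENNReal.ofReal_le_ofReal
              simp only [gaussianPDFReal, NNReal.coe_one, mul_one]
              have hpi : (1:ℝ) ≤ √(2 * π) := by
                rw [Real.one_le_sqrt]; nlinarith [Real.pi_gt_three]
              calc _ ≤ 1 * rexp (-(s - m j) ^ 2 / 2) := by
                    gcongr; exact inv_le_one_of_one_le₀ hpi
                _ ≤ _ := by
                    rw [one_mul]; gcongr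
    have hdisj : ∑ j, P (J j (Set.Ioi s)) ≤ 1 := by
      rw [← measure_biUnion_finset ?_ (fun j _ => hJm j _ measurableSet_Ioi)]
      · exact prob_le_one
      · intro i _ j _ hij
        refine Set.disjoint_left.2 fun ω hi hj => ?_
        rcases lt_or_gt_of_ne hij with h | h
        · exact absurd ((hj.2 i).1 h) (not_lt.2 ((hi.2 j).2 h))
        · exact absurd ((hi.2 j).1 h) (not_lt.2 ((hj.2 i).2 h))
    calc _ ≤ ∑ j, (ENNReal.ofReal (L + 1) * P (J j (Set.Ioi s)) +
            ENNReal.ofReal (rexp (-L ^ 2 / 2))) := Finset.sum_le_sum fun j _ => hterm j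
      _ = ENNReal.ofReal (L + 1) * ∑ j, P (J j (Set.Ioi s)) +
          ENNReal.ofReal ((Fintype.card ι : ℝ) * rexp (-L ^ 2 / 2)) := by
          rw [Finset.sum_add_distrib, ← Finset.mul_sum, ENNReal.ofReal_mul (by positivity)]
          simp
      _ ≤ ENNReal.ofReal (L + 1) * 1 + ENNReal.ofReal 1 := by
          gcongr
      _ = _ := by
          rw [mul_one, ← ENNReal.ofReal_add (by positivity) (by positivity)]; congr 1; ring
  have hsub : {ω | ∀ i, U i ω ≤ δ} ⊆ {ω | ∀ i, U i ω ≤ 0} ∪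
      ⋃ j ∈ (Finset.univ : Finset ι), J j (Set.Ioc 0 δ) := by
    intro ω hω
    by_cases h0 : ∀ i, U i ω ≤ 0
    · exact Or.inl h0
    right
    push Not at h0
    obtain ⟨i0, hi0⟩ := h0
    obtain ⟨i1, -, hi1⟩ := Finset.exists_max_image Finset.univ (fun i => U i ω) ⟨i0, Finset.mem_univ _⟩
    set F : Finset ι := Finset.univ.filter fun i => U i ω = U i1 ω with hF
    have hFne : F.Nonempty := ⟨i1, by simp [hF]⟩
    have hj := F.min'_mem hFne
    set j := F.min' hFne with hjdef
    have hjeq : U j ω = U i1 ω := by simpa [hF] using hj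
    simp only [Set.mem_iUnion]
    refine ⟨j, Finset.mem_univ _, ⟨?_, hω j⟩, fun k => ⟨fun hk => ?_, fun _ => ?_⟩⟩
    · rw [hjeq]; exact hi0.trans_le (hi1 i0 (Finset.mem_univ _))
    · rw [hjeq]
      refine lt_of_le_of_ne (hi1 k (Finset.mem_univ _)) fun he => ?_
      have : k ∈ F := by simp [hF, he]
      exact absurd (F.min'_le k this) (not_le.2 hk)
    · rw [hjeq]; exact hi1 k (Finset.mem_univ _)
  calc P {ω | ∀ i, U i ω ≤ δ} ≤ P {ω | ∀ i, U i ω ≤ 0} +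
        P (⋃ j ∈ (Finset.univ : Finset ι), J j (Set.Ioc 0 δ)) :=
        (measure_mono hsub).trans (measure_union_le _ _)
    _ ≤ P {ω | ∀ i, U i ω ≤ 0} + ∑ j, P (J j (Set.Ioc 0 δ)) := by
        gcongr; exact measure_biUnion_finset_le _ _
    _ = P {ω | ∀ i, U i ω ≤ 0} + ∫⁻ s in Set.Ioc 0 δ, ∑ j, gaussianPDF (m j) 1 s * G j s := by
        rw [lintegral_finsetSum]
        · congr 1
          exact Finset.sum_congr rfl fun j _ => hGint j _ measurableSet_Ioc
        · exact fun j _ => (measurable_gaussianPDF _ _).mul (hGmono j).measurable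
    _ ≤ P {ω | ∀ i, U i ω ≤ 0} + ∫⁻ s in Set.Ioc 0 δ, ENNReal.ofReal (L + 2) := by
        gcongr with s; exact hpt s
    _ = _ := by
        rw [setLIntegral_const, Real.volume_Ioc, sub_zero, ← ENNReal.ofReal_mul (by positivity)]

/-- Two-sided Gaussian anti-concentration over hyperrectangles: upper bound. -/
theorem stmt_7 {Ω : Type*} [MeasurableSpace Ω] (P : Measure Ω) [IsProbabilityMeasure P]
    (d : ℕ) (hd : 1 ≤ d) (Z : Ω → (Fin d → ℝ)) (hZ : Measurable Z)
    (S : Matrix (Fin d) (Fin d) ℝ)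
    -- `Z ~ N_d(0, S)`: every linear functional of `Z` is a centered Gaussian with the
    -- variance given by the corresponding quadratic form of `S`.
    (hGauss : ∀ l : Fin d → ℝ,
      P.map (fun ω => ∑ j, l j * Z ω j) =
        gaussianReal 0 (∑ j, ∑ k, l j * S j k * l k).toNNReal)
    (σ : ℝ) (hσ : 0 < σ) (hdiag : ∀ j, σ ^ 2 ≤ S j j)
    (δ₁ δ₂ : ℝ) (a b : Fin d → EReal) :
    (P {ω | ∀ j, a j + (δ₁ : EReal) ≤ (Z ω j : EReal) ∧
        (Z ω j : EReal) ≤ b j + (δ₂ : EReal)}).toReal ≤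
      (P {ω | ∀ j, a j ≤ (Z ω j : EReal) ∧ (Z ω j : EReal) ≤ b j}).toReal +
        (max |δ₁| |δ₂| / σ) * (Real.sqrt (2 * Real.log d) + 4) := by
  classical
  set D := max |δ₁| |δ₂| with hD
  have hD0 : 0 ≤ D := (abs_nonneg δ₁).trans (le_max_left _ _)
  have hD1 : |δ₁| ≤ D := le_max_left _ _
  have hD2 : |δ₂| ≤ D := le_max_right _ _
  by_cases hbad : (∃ j, a j = ⊤) ∨ (∃ j, b j = ⊥)
  · have : {ω | ∀ j, a j + (δ₁ : EReal) ≤ (Z ω j : EReal) ∧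
        (Z ω j : EReal) ≤ b j + (δ₂ : EReal)} = ∅ := by
      ext ω
      simp only [Set.mem_ofPred_eq, Set.mem_empty_iff_false, iff_false]
      intro h
      rcases hbad with ⟨j, hj⟩ | ⟨j, hj⟩
      · have := (h j).1
        rw [hj, EReal.top_add_coe] at this
        exact EReal.coe_ne_top _ (top_le_iff.1 this)
      · have := (h j).2
        rw [hj, EReal.bot_add] at this
        exact EReal.coe_ne_bot _ (le_bot_iff.1 this)
    rw [this]
    simp only [measure_empty, ENNReal.toReal_zero]
    positivity
  push Not at hbad
  obtain ⟨haT, hbB⟩ := hbad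
  -- standard deviations
  set t : Fin d → ℝ := fun j => √(S j j) with ht
  have hSpos : ∀ j, 0 < S j j := fun j => lt_of_lt_of_le (by positivity) (hdiag j)
  have htσ : ∀ j, σ ≤ t j := fun j => Real.le_sqrt_of_sq_le (hdiag j)
  have htpos : ∀ j, 0 < t j := fun j => hσ.trans_le (htσ j)
  -- coordinates
  have hZj : ∀ j, Measurable fun ω => Z ω j := fun j => (measurable_pi_apply j).comp hZ
  have hZlaw : ∀ j, P.map (fun ω => Z ω j) = gaussianReal 0 (S j j).toNNReal := by
    intro j
    have := hGauss (Pi.single j 1)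
    simpa [Pi.single_apply] using this
  have hZG : HasGaussianLaw Z P := by
    refine ⟨isGaussian_of_map_eq_gaussianReal fun L => ?_⟩
    refine ⟨0, (∑ j, ∑ k, L (Pi.single j 1) * S j k * L (Pi.single k 1)).toNNReal, ?_⟩
    rw [← hGauss, Measure.map_map (by fun_prop) hZ]
    congr 1
    ext ω
    simp only [Function.comp]
    conv_lhs => rw [pi_eq_sum_univ' (Z ω)]
    simp [mul_comm, Pi.single_apply]
  -- the standardised one-sided vector
  let ι := {j : Fin d // b j ≠ ⊤} ⊕ {j : Fin d // a j ≠ ⊥}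
  let U : ι → Ω → ℝ := fun i => Sum.elim
    (fun j ω => (t j.1)⁻¹ * Z ω j.1 + -((t j.1)⁻¹ * (b j.1).toReal))
    (fun j ω => -(t j.1)⁻¹ * Z ω j.1 + (t j.1)⁻¹ * (a j.1).toReal) i
  let mm : ι → ℝ := Sum.elim (fun j => -((t j.1)⁻¹ * (b j.1).toReal))
    (fun j => (t j.1)⁻¹ * (a j.1).toReal)
  letI : LinearOrder ι := LinearOrder.lift' (Fintype.equivFin ι) (Fintype.equivFin ι).injective
  have hUm : ∀ i, Measurable (U i) := by
    rintro (j | j)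
    · exact ((hZj j.1).const_mul _).add_const _
    · exact ((hZj j.1).const_mul _).add_const _
  have hUG : HasGaussianLaw (fun ω i => U i ω) P := by
    let T : (Fin d → ℝ) →L[ℝ] (ι → ℝ) := ContinuousLinearMap.pi (fun i =>
      Sum.elim (fun j => (t j.1)⁻¹ • ContinuousLinearMap.proj (R := ℝ) (φ := fun _ : Fin d => ℝ) j.1)
        (fun j => (-(t j.1)⁻¹) • ContinuousLinearMap.proj (R := ℝ) (φ := fun _ : Fin d => ℝ) j.1) i)
    have h1 := hZG.map_fun T
    have h2 := h1.isGaussian_map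
    have h3 : IsGaussian ((P.map (fun ω => T (Z ω))).map (fun x => x + mm)) := inferInstance
    rw [Measure.map_map (by fun_prop) (by fun_prop)] at h3
    refine ⟨?_⟩
    convert h3 using 2
    ext ω i
    rcases i with j | j <;> simp [U, T, mm]
  have hscale : ∀ (j : Fin d) (c e : ℝ), c ^ 2 * S j j = 1 →
      P.map (fun ω => c * Z ω j + e) = gaussianReal e 1 := by
    intro j c e hc
    have h1 : P.map (fun ω => c * Z ω j + e) =
        ((P.map (fun ω => Z ω j)).map (c * ·)).map (· + e) := by
      rw [Measure.map_map (by fun_prop) (hZj j), Measure.map_map (by fun_prop) (by fun_prop)]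
      rfl
    rw [h1, hZlaw, gaussianReal_map_const_mul, gaussianReal_map_add_const]
    congr 1
    · simp
    · ext
      simp [hc, (hSpos j).le]
  have htsq : ∀ j, (t j)⁻¹ ^ 2 * S j j = 1 := by
    intro j
    rw [inv_pow, Real.sq_sqrt (hSpos j).le, inv_mul_cancel₀ (hSpos j).ne']
  have hUlaw : ∀ i, P.map (U i) = gaussianReal (mm i) 1 := by
    rintro (j | j)
    · exact hscale j.1 _ _ (htsq _)
    · exact hscale j.1 _ _ (by rw [neg_sq]; exact htsq _)
  set L := √(2 * Real.log (2 * d)) with hL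
  have hd1 : (1:ℝ) ≤ d := by exact_mod_cast hd
  have hlogd : 0 ≤ Real.log d := Real.log_nonneg hd1
  have hlog2d : Real.log (2 * d) = Real.log 2 + Real.log d :=
    Real.log_mul (by norm_num) (by positivity)
  have hlog2 : 0 < Real.log 2 := Real.log_pos (by norm_num)
  have hL0 : 0 ≤ L := Real.sqrt_nonneg _
  have hLsq : L ^ 2 = 2 * Real.log (2 * d) := Real.sq_sqrt (by rw [hlog2d]; positivity)
  have hcard : (Fintype.card ι : ℝ) * rexp (-L ^ 2 / 2) ≤ 1 := by
    have h1 : Fintype.card ι ≤ 2 * d := by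
      rw [Fintype.card_sum, two_mul]
      refine add_le_add ?_ ?_
      · simpa using Fintype.card_subtype_le (fun j : Fin d => b j ≠ ⊤)
      · simpa using Fintype.card_subtype_le (fun j : Fin d => a j ≠ ⊥)
    have h1' : (Fintype.card ι : ℝ) ≤ 2 * d := by exact_mod_cast h1
    have h2 : rexp (-L ^ 2 / 2) = (2 * (d:ℝ))⁻¹ := by
      rw [hLsq, show -(2 * Real.log (2 * d)) / 2 = -Real.log (2 * d) by ring, Real.exp_neg,
        Real.exp_log (by positivity)]
    rw [h2, ← div_eq_mul_inv, div_le_one (by positivity)]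
    exact h1'
  have hmain := nazarov_aux P U hUm hUG mm hUlaw L (D / σ) hL0 hcard
  have hsub1 : {ω | ∀ j, a j + (δ₁ : EReal) ≤ (Z ω j : EReal) ∧
        (Z ω j : EReal) ≤ b j + (δ₂ : EReal)} ⊆ {ω | ∀ i, U i ω ≤ D / σ} := by
    intro ω hω i
    have hgen : ∀ j : Fin d, D ≤ t j * (D / σ) := by
      intro j
      calc D = σ * (D / σ) := by field_simp
        _ ≤ _ := by gcongr; exact htσ j
    rcases i with ⟨j, hj⟩ | ⟨j, hj⟩
    · have h := (hω j).2
      rw [← EReal.coe_toReal hj (hbB j), ← EReal.coe_add, EReal.coe_le_coe_iff] at h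
      show (t j)⁻¹ * Z ω j + -((t j)⁻¹ * (b j).toReal) ≤ D / σ
      rw [← sub_eq_add_neg, ← mul_sub, inv_mul_le_iff₀ (htpos j)]
      linarith [hgen j, le_abs_self δ₂]
    · have h := (hω j).1
      rw [← EReal.coe_toReal (haT j) hj, ← EReal.coe_add, EReal.coe_le_coe_iff] at h
      show -(t j)⁻¹ * Z ω j + (t j)⁻¹ * (a j).toReal ≤ D / σ
      rw [neg_mul, neg_add_eq_sub, ← mul_sub, inv_mul_le_iff₀ (htpos j)]
      linarith [hgen j, neg_abs_le δ₁]
  have hsub2 : {ω | ∀ i, U i ω ≤ 0} ⊆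
      {ω | ∀ j, a j ≤ (Z ω j : EReal) ∧ (Z ω j : EReal) ≤ b j} := by
    intro ω hω j
    constructor
    · by_cases hj : a j = ⊥
      · rw [hj]; exact bot_le
      · have h : -(t j)⁻¹ * Z ω j + (t j)⁻¹ * (a j).toReal ≤ 0 := hω (Sum.inr ⟨j, hj⟩)
        rw [neg_mul, neg_add_eq_sub, ← mul_sub, inv_mul_le_iff₀ (htpos j)] at h
        rw [← EReal.coe_toReal (haT j) hj, EReal.coe_le_coe_iff]
        linarith
    · by_cases hj : b j = ⊤
      · rw [hj]; exact le_top
      · have h : (t j)⁻¹ * Z ω j + -((t j)⁻¹ * (b j).toReal) ≤ 0 := hω (Sum.inl ⟨j, hj⟩)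
        rw [← sub_eq_add_neg, ← mul_sub, inv_mul_le_iff₀ (htpos j)] at h
        rw [← EReal.coe_toReal hj (hbB j), EReal.coe_le_coe_iff]
        linarith
  have hLle : L + 2 ≤ √(2 * Real.log d) + 4 := by
    have h1 : L ≤ √(2 * Real.log d) + 2 := by
      rw [hL, hlog2d]
      apply Real.sqrt_le_iff.2
      refine ⟨by positivity, ?_⟩
      have h2 := Real.sq_sqrt (show 0 ≤ 2 * Real.log d by positivity)
      have h3 := Real.sqrt_nonneg (2 * Real.log d)
      nlinarith [Real.log_two_lt_d9]
    linarith
  have hfin : P {ω | ∀ j, a j + (δ₁ : EReal) ≤ (Z ω j : EReal) ∧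
        (Z ω j : EReal) ≤ b j + (δ₂ : EReal)} ≤
      P {ω | ∀ j, a j ≤ (Z ω j : EReal) ∧ (Z ω j : EReal) ≤ b j} +
        ENNReal.ofReal ((D / σ) * (√(2 * Real.log d) + 4)) := by
    refine (measure_mono hsub1).trans (hmain.trans ?_)
    refine add_le_add (measure_mono hsub2) (ENNReal.ofReal_le_ofReal ?_)
    rw [mul_comm]
    gcongr
  have := ENNReal.toReal_mono (by finiteness) hfin
  rwa [ENNReal.toReal_add (by finiteness) (by finiteness),
    ENNReal.toReal_ofReal (by positivity)] at this
end

section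
/- Let Z ~ N_d(0, Σ) with Σ_{jj} ≥ σ̲² > 0 for all j. Then for all real δ₁, δ₂ and all a, b ∈ (ℝ ∪ {±∞})^d, with δ̄ = max(|δ₁|, |δ₂|): P(Z ∈ [a + δ₁, b + δ₂]) ≥ P(Z ∈ [a, b]) − (δ̄/σ̲)(√(2 log d) + 4). -/
open MeasureTheory ProbabilityTheory Real

lemma phi_eq (u : ℝ) : gaussianPDFReal 0 1 u = (√(2 * π))⁻¹ * rexp (-u ^ 2 / 2) := by
  simp [gaussianPDFReal]

lemma phi_anti {s t : ℝ} (hs : 0 ≤ s) (hst : s ≤ t) :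
    gaussianPDFReal 0 1 t ≤ gaussianPDFReal 0 1 s := by
  rw [phi_eq, phi_eq]
  gcongr

lemma phi_le_zero (s : ℝ) : gaussianPDFReal 0 1 s ≤ gaussianPDFReal 0 1 0 := by
  rw [phi_eq, phi_eq]
  refine mul_le_mul_of_nonneg_left (Real.exp_le_exp.2 ?_) (by positivity)
  nlinarith [sq_nonneg s]

lemma phi_hasDeriv (x : ℝ) :
    HasDerivAt (gaussianPDFReal 0 1) (-x * gaussianPDFReal 0 1 x) x := by
  have h1 : gaussianPDFReal 0 1 = fun u => (√(2 * π))⁻¹ * rexp (-u ^ 2 / 2) := funext phi_eq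
  have h2 : HasDerivAt (fun u : ℝ => -u ^ 2 / 2) (-x) x := by
    have := ((hasDerivAt_pow 2 x).fun_neg.div_const 2)
    refine this.congr_deriv ?_
    norm_num
    ring
  have h3 := (h2.exp).const_mul ((√(2 * π))⁻¹)
  rw [h1]
  refine h3.congr_deriv ?_
  ring

lemma phi_tendsto : Filter.Tendsto (gaussianPDFReal 0 1) Filter.atTop (nhds 0) := by
  have h1 : gaussianPDFReal 0 1 = fun u => (√(2 * π))⁻¹ * rexp (-u ^ 2 / 2) := funext phi_eq
  rw [h1, ← mul_zero ((√(2 * π))⁻¹)]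
  refine Filter.Tendsto.const_mul _ (Real.tendsto_exp_atBot.comp ?_)
  have : Filter.Tendsto (fun u : ℝ => u ^ 2 / 2) Filter.atTop Filter.atTop :=
    (Filter.tendsto_pow_atTop (by norm_num)).atTop_div_const (by norm_num)
  have := Filter.tendsto_neg_atTop_atBot.comp this
  refine this.congr (fun u => ?_)
  simp [neg_div]

lemma mills_nonneg {u : ℝ} (hu : 0 ≤ u) :
    gaussianPDFReal 0 1 u ≤ (u + 1) * ∫ x in Set.Ioi u, gaussianPDFReal 0 1 x := by
  set φ := gaussianPDFReal 0 1 with hφ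
  have hd : ∀ x ∈ Set.Ici u, HasDerivAt (fun x => φ x / (x + 1))
      (-(φ x * ((x ^ 2 + x + 1) / (x + 1) ^ 2))) x := by
    intro x hx
    have hx0 : 0 ≤ x := hu.trans hx
    have hx1 : x + 1 ≠ 0 := by positivity
    have := (phi_hasDeriv x).div ((hasDerivAt_id x).add_const 1) hx1
    refine this.congr_deriv ?_
    simp only [id, ← hφ]
    field_simp
    ring
  have hr : ∀ x ∈ Set.Ioi u, φ x * ((x ^ 2 + x + 1) / (x + 1) ^ 2) ≤ φ x := by
    intro x hx
    have hx0 : 0 ≤ x := hu.trans (le_of_lt hx)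
    refine mul_le_of_le_one_right (gaussianPDFReal_nonneg _ _ _) ?_
    rw [div_le_one (by positivity)]
    nlinarith
  have hintg : IntegrableOn φ (Set.Ioi u) := (integrable_gaussianPDFReal 0 1).integrableOn
  have hint2 : IntegrableOn (fun x => φ x * ((x ^ 2 + x + 1) / (x + 1) ^ 2)) (Set.Ioi u) := by
    refine Integrable.mono' hintg ?_ ?_
    · exact ((measurable_gaussianPDFReal 0 1).mul (by fun_prop)).aestronglyMeasurable
    · refine (ae_restrict_iff' measurableSet_Ioi).2 (Filter.Eventually.of_forall fun x hx => ?_)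
      have hx0 : 0 ≤ x := hu.trans (le_of_lt hx)
      rw [Real.norm_of_nonneg]
      · exact hr x hx
      · exact mul_nonneg (gaussianPDFReal_nonneg _ _ _) (by positivity)
  have ht : Filter.Tendsto (fun x => φ x / (x + 1)) Filter.atTop (nhds 0) :=
    phi_tendsto.div_atTop (Filter.tendsto_atTop_add_const_right _ _ Filter.tendsto_id)
  have key := integral_Ioi_of_hasDerivAt_of_tendsto' hd hint2.neg ht
  rw [integral_neg] at key
  have hmono := setIntegral_mono_on hint2 hintg measurableSet_Ioi hr
  have : φ u / (u + 1) ≤ ∫ x in Set.Ioi u, φ x := by linarith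
  rw [div_le_iff₀ (by positivity)] at this
  linarith

lemma mills {u T : ℝ} (hT : 0 ≤ T) (hu : u ≤ T) :
    gaussianPDF 0 1 u ≤ ENNReal.ofReal (T + 1) * gaussianReal 0 1 (Set.Ici u) := by
  have h : gaussianPDFReal 0 1 u ≤ (T + 1) * ∫ x in Set.Ioi u, gaussianPDFReal 0 1 x := by
    rcases le_total 0 u with h0 | h0
    · refine (mills_nonneg h0).trans ?_
      gcongr
      exact integral_nonneg fun x => gaussianPDFReal_nonneg _ _ _
    · have h1 := (phi_le_zero u).trans (mills_nonneg le_rfl)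
      have h2 : ∫ x in Set.Ioi 0, gaussianPDFReal 0 1 x ≤ ∫ x in Set.Ioi u, gaussianPDFReal 0 1 x :=
        setIntegral_mono_set (integrable_gaussianPDFReal 0 1).integrableOn
          (Filter.Eventually.of_forall fun x => gaussianPDFReal_nonneg _ _ _)
          (Filter.Eventually.of_forall (Set.Ioi_subset_Ioi h0))
      have h3 : 0 ≤ ∫ x in Set.Ioi u, gaussianPDFReal 0 1 x :=
        integral_nonneg fun x => gaussianPDFReal_nonneg _ _ _
      nlinarith
  calc gaussianPDF 0 1 u ≤ ENNReal.ofReal ((T + 1) * ∫ x in Set.Ioi u, gaussianPDFReal 0 1 x) :=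
        ENNReal.ofReal_le_ofReal h
    _ = ENNReal.ofReal (T + 1) * gaussianReal 0 1 (Set.Ioi u) := by
        rw [ENNReal.ofReal_mul (by positivity), gaussianReal_apply_eq_integral _ one_ne_zero]
    _ ≤ _ := by gcongr; exact Set.Ioi_subset_Ici_self

lemma slab_bound {g : ℝ → ENNReal} (hg : Monotone g) (hg1 : ∀ u, g u ≤ 1) {T : ℝ} (hT : 0 ≤ T)
    (y δ : ℝ) :
    ∫⁻ u in Set.Ioc y (y + δ), g u ∂(gaussianReal 0 1) ≤
      ENNReal.ofReal δ * (ENNReal.ofReal (T + 1) * ∫⁻ u, g u ∂(gaussianReal 0 1)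
        + gaussianPDF 0 1 T) := by
  have hgm : Measurable g := hg.measurable
  have hpt : ∀ u, gaussianPDF 0 1 u * g u ≤
      ENNReal.ofReal (T + 1) * ∫⁻ u, g u ∂(gaussianReal 0 1) + gaussianPDF 0 1 T := by
    intro u
    rcases le_total u T with h | h
    · refine le_trans ?_ le_self_add
      calc gaussianPDF 0 1 u * g u
          ≤ ENNReal.ofReal (T + 1) * gaussianReal 0 1 (Set.Ici u) * g u := by
            gcongr; exact mills hT h
        _ = ENNReal.ofReal (T + 1) * (g u * gaussianReal 0 1 (Set.Ici u)) := by ring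
        _ ≤ _ := by
            gcongr
            rw [← setLIntegral_const]
            refine (setLIntegral_mono hgm fun x hx => hg hx).trans (setLIntegral_le_lintegral _ _)
    · refine le_trans ?_ le_add_self
      calc gaussianPDF 0 1 u * g u ≤ gaussianPDF 0 1 u * 1 := by gcongr; exact hg1 u
        _ ≤ _ := by rw [mul_one]; exact ENNReal.ofReal_le_ofReal (phi_anti hT h)
  rw [gaussianReal_of_var_ne_zero _ one_ne_zero, setLIntegral_withDensity_eq_setLIntegral_mul _
    (measurable_gaussianPDF 0 1) hgm measurableSet_Ioc, ← gaussianReal_of_var_ne_zero _ one_ne_zero]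
  refine (setLIntegral_mono measurable_const fun x _ => hpt x).trans ?_
  rw [setLIntegral_const, Real.volume_Ioc, mul_comm]
  simp

/-- `i` is the first index at which `U j - y j` is maximal. -/
def argmaxSet {Ω ι : Type*} [LinearOrder ι] (U : ι → Ω → ℝ) (y : ι → ℝ) (i : ι) : Set Ω :=
  {ω | ∀ j, (j < i → U j ω - y j < U i ω - y i) ∧ U j ω - y j ≤ U i ω - y i}

lemma slice {Ω ι : Type*} [MeasurableSpace Ω] {P : Measure Ω} [IsProbabilityMeasure P]
    [Fintype ι] [LinearOrder ι] {U : ι → Ω → ℝ} (hm : ∀ i, Measurable (U i))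
    (hU : HasGaussianLaw (fun ω => (U · ω)) P)
    (h1 : ∀ i, P.map (U i) = gaussianReal 0 1) (y : ι → ℝ) (i : ι) :
    ∃ g : ℝ → ENNReal, Monotone g ∧ (∀ u, g u ≤ 1) ∧ ∀ B : Set ℝ, MeasurableSet B →
      P (argmaxSet U y i ∩ U i ⁻¹' B) = ∫⁻ u in B, g u ∂(gaussianReal 0 1) := by
  have hL2 : ∀ j, MemLp (U j) 2 P := fun j => (hU.eval j).memLp_two
  have hvar : ∀ j, Var[U j; P] = 1 := by
    intro j
    have := variance_map (X := id) (Y := U j) (μ := P) (by fun_prop) (hm j).aemeasurable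
    rw [h1 j] at this
    simpa using this.symm
  set c : ι → ℝ := fun j => cov[U i, U j; P] with hc
  have hc1 : ∀ j, c j ≤ 1 := by
    intro j
    have h := variance_sub (hL2 i) (hL2 j)
    have h0 := variance_nonneg (U i - U j) P
    rw [hvar, hvar] at h
    simp only [hc]
    linarith
  set V : ι → Ω → ℝ := fun j ω => U j ω - c j * U i ω with hV
  have hVm : Measurable (fun ω j => V j ω) := by
    refine measurable_pi_lambda _ fun j => ?_
    exact (hm j).sub ((hm i).const_mul _)
  have hcov : ∀ j, cov[U i, V j; P] = 0 := by
    intro j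
    have := covariance_fun_sub_right (hL2 i) (hL2 j) ((hL2 i).const_mul (c j))
    simp only [hV]
    rw [this, covariance_const_mul_right, covariance_self (hm i).aemeasurable, hvar]
    simp [hc]
  have hind : IndepFun (U i) (fun ω j => V j ω) P := by
    have hpair : HasGaussianLaw (fun ω => ((fun _ : Unit => U i ω), fun j => V j ω)) P := by
      let A : (ι → ℝ) →L[ℝ] (Unit → ℝ) × (ι → ℝ) :=
        (ContinuousLinearMap.pi fun _ : Unit => ContinuousLinearMap.proj i).prod
          (ContinuousLinearMap.pi fun j => ContinuousLinearMap.proj j -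
            c j • ContinuousLinearMap.proj i)
      exact hU.map_fun A
    have := hpair.indepFun_of_covariance_eval (X := fun _ : Unit => U i) (Y := V)
      (fun _ j => hcov j)
    exact this.comp (φ := fun f : Unit → ℝ => f ()) (ψ := id) (measurable_pi_apply _) measurable_id
  have hprod := (indepFun_iff_map_prod_eq_prod_map_map (hm i).aemeasurable hVm.aemeasurable).1 hind
  set ν := P.map (fun ω j => V j ω) with hν
  have : IsProbabilityMeasure ν := Measure.isProbabilityMeasure_map hVm.aemeasurable
  let R : Set (ℝ × (ι → ℝ)) := {p | ∀ j, (j < i → p.2 j + c j * p.1 - y j < p.1 - y i) ∧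
    p.2 j + c j * p.1 - y j ≤ p.1 - y i}
  have hR : MeasurableSet R := by
    have : R = ⋂ j, ({p : ℝ × (ι → ℝ) | j < i → p.2 j + c j * p.1 - y j < p.1 - y i} ∩
        {p | p.2 j + c j * p.1 - y j ≤ p.1 - y i}) := by
      ext p; simp [R]
    rw [this]
    refine MeasurableSet.iInter fun j => MeasurableSet.inter ?_ ?_
    · by_cases hj : j < i
      · simp only [hj, true_imp_iff]
        exact measurableSet_lt (by fun_prop) (by fun_prop)
      · simp [hj]
    · exact measurableSet_le (by fun_prop) (by fun_prop)
  refine ⟨fun u => ν (Prod.mk u ⁻¹' R), ?_, fun u => prob_le_one, ?_⟩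
  · intro u w huw
    refine measure_mono ?_
    intro v hv j
    have h2 := hc1 j
    have h3 : c j * w - w ≤ c j * u - u := by nlinarith
    obtain ⟨ha, hb⟩ := hv j
    simp only at ha hb ⊢
    exact ⟨fun hj => by linarith [ha hj], by linarith⟩
  · intro B hB
    have hset : argmaxSet U y i ∩ U i ⁻¹' B =
        (fun ω => (U i ω, fun j => V j ω)) ⁻¹' (R ∩ (Prod.fst ⁻¹' B)) := by
      ext ω
      simp [argmaxSet, R, hV]
    rw [hset, ← Measure.map_apply ((hm i).prodMk hVm) (hR.inter (measurable_fst hB)), hprod, h1 i,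
      Measure.prod_apply (hR.inter (measurable_fst hB)), ← lintegral_indicator hB]
    refine lintegral_congr fun u => ?_
    by_cases hu : u ∈ B
    · simp [hu, Set.preimage_inter, ← Set.preimage_comp, Function.comp_def]
    · simp [hu, Set.preimage_inter, ← Set.preimage_comp, Function.comp_def]

lemma nazarov {Ω ι : Type*} [MeasurableSpace Ω] {P : Measure Ω} [IsProbabilityMeasure P]
    [Fintype ι] {U : ι → Ω → ℝ} (hm : ∀ i, Measurable (U i))
    (hU : HasGaussianLaw (fun ω => (U · ω)) P)
    (h1 : ∀ i, P.map (U i) = gaussianReal 0 1) (y : ι → ℝ) (δ : ℝ) {T : ℝ} (hT : 0 ≤ T) :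
    P ({ω | ∀ i, U i ω ≤ y i + δ} \ {ω | ∀ i, U i ω ≤ y i}) ≤
      ENNReal.ofReal δ * (ENNReal.ofReal (T + 1) + Fintype.card ι * gaussianPDF 0 1 T) := by
  let _ : LinearOrder ι := LinearOrder.lift' (Fintype.equivFin ι) (Fintype.equivFin ι).injective
  have hcover : ({ω | ∀ i, U i ω ≤ y i + δ} \ {ω | ∀ i, U i ω ≤ y i}) ⊆
      ⋃ i, (argmaxSet U y i ∩ U i ⁻¹' (Set.Ioc (y i) (y i + δ))) := by
    rintro ω ⟨ha, hb⟩
    simp only [Set.mem_ofPred_eq, not_forall, not_le] at ha hb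
    obtain ⟨k, hk⟩ := hb
    obtain ⟨m, -, hmax⟩ := Finset.exists_max_image Finset.univ (fun j => U j ω - y j) ⟨k, by simp⟩
    let F : Finset ι := Finset.univ.filter fun i => ∀ j, U j ω - y j ≤ U i ω - y i
    have hF : F.Nonempty := ⟨m, by simpa [F] using hmax⟩
    have hi := F.min'_mem hF
    set i := F.min' hF with hi'
    have hi2 : ∀ j, U j ω - y j ≤ U i ω - y i := by simpa [F] using hi
    refine Set.mem_iUnion.2 ⟨i, fun j => ⟨fun hj => ?_, hi2 j⟩, ?_, ha i⟩
    · by_contra hcon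
      push Not at hcon
      have : j ∈ F := by
        simp only [F, Finset.mem_filter, Finset.mem_univ, true_and]
        exact fun l => (hi2 l).trans hcon
      exact absurd (F.min'_le j this) (not_le.2 hj)
    · have := hi2 k
      linarith
  have hmeas : ∀ i, MeasurableSet (argmaxSet U y i) := by
    intro i
    have : argmaxSet U y i = ⋂ j, ({ω | j < i → U j ω - y j < U i ω - y i} ∩
        {ω | U j ω - y j ≤ U i ω - y i}) := by
      ext p; simp [argmaxSet]
    rw [this]
    refine MeasurableSet.iInter fun j => MeasurableSet.inter ?_ ?_
    · by_cases hj : j < i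
      · simp only [hj, true_imp_iff]
        exact measurableSet_lt (by fun_prop) (by fun_prop)
      · simp [hj]
    · exact measurableSet_le (by fun_prop) (by fun_prop)
  have hdisj : Pairwise (Function.onFun Disjoint (argmaxSet U y)) := by
    intro i j hij
    refine Set.disjoint_left.2 fun ω hi hj => ?_
    rcases lt_or_gt_of_ne hij with h | h
    · exact absurd ((hj i).1 h) (not_lt.2 (hi j).2)
    · exact absurd ((hi j).1 h) (not_lt.2 (hj i).2)
  have hsum : ∑ i, P (argmaxSet U y i) ≤ 1 := by
    rw [← tsum_fintype (L := .unconditional _), ← measure_iUnion hdisj hmeas]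
    exact prob_le_one
  have hterm : ∀ i, P (argmaxSet U y i ∩ U i ⁻¹' (Set.Ioc (y i) (y i + δ))) ≤
      ENNReal.ofReal δ * (ENNReal.ofReal (T + 1) * P (argmaxSet U y i) + gaussianPDF 0 1 T) := by
    intro i
    obtain ⟨g, hg, hg1, hB⟩ := slice hm hU h1 y i
    have huniv := hB Set.univ MeasurableSet.univ
    simp only [Set.preimage_univ, Set.inter_univ, Measure.restrict_univ] at huniv
    rw [hB _ measurableSet_Ioc, huniv]
    exact slab_bound hg hg1 hT _ _
  calc _ ≤ ∑ i, P (argmaxSet U y i ∩ U i ⁻¹' (Set.Ioc (y i) (y i + δ))) :=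
        (measure_mono hcover).trans (measure_iUnion_fintype_le _ _)
    _ ≤ ∑ i, ENNReal.ofReal δ *
          (ENNReal.ofReal (T + 1) * P (argmaxSet U y i) + gaussianPDF 0 1 T) :=
        Finset.sum_le_sum fun i _ => hterm i
    _ = ENNReal.ofReal δ * (ENNReal.ofReal (T + 1) * ∑ i, P (argmaxSet U y i) +
          Fintype.card ι * gaussianPDF 0 1 T) := by
        rw [← Finset.mul_sum, Finset.sum_add_distrib, ← Finset.mul_sum]
        simp
    _ ≤ ENNReal.ofReal δ * (ENNReal.ofReal (T + 1) * 1 + Fintype.card ι * gaussianPDF 0 1 T) := by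
        gcongr
    _ = _ := by rw [mul_one]

/-- Two-sided Gaussian anti-concentration over hyperrectangles: lower bound. -/
theorem stmt_8 {Ω : Type*} [MeasurableSpace Ω] (P : Measure Ω) [IsProbabilityMeasure P]
    (d : ℕ) (hd : 1 ≤ d) (Z : Ω → (Fin d → ℝ)) (hZ : Measurable Z)
    (S : Matrix (Fin d) (Fin d) ℝ)
    -- `Z ~ N_d(0, S)`: every linear functional of `Z` is a centered Gaussian with the
    -- variance given by the corresponding quadratic form of `S`.
    (hGauss : ∀ l : Fin d → ℝ,
      P.map (fun ω => ∑ j, l j * Z ω j) =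
        gaussianReal 0 (∑ j, ∑ k, l j * S j k * l k).toNNReal)
    (σ : ℝ) (hσ : 0 < σ) (hdiag : ∀ j, σ ^ 2 ≤ S j j)
    (δ₁ δ₂ : ℝ) (a b : Fin d → EReal) :
    (P {ω | ∀ j, a j + (δ₁ : EReal) ≤ (Z ω j : EReal) ∧
        (Z ω j : EReal) ≤ b j + (δ₂ : EReal)}).toReal ≥
      (P {ω | ∀ j, a j ≤ (Z ω j : EReal) ∧ (Z ω j : EReal) ≤ b j}).toReal -
        (max |δ₁| |δ₂| / σ) * (Real.sqrt (2 * Real.log d) + 4) := by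
  set δ := max |δ₁| |δ₂| with hδ
  have hδ0 : 0 ≤ δ := (abs_nonneg δ₁).trans (le_max_left _ _)
  have hδ1 : δ₁ ≤ δ := (le_abs_self δ₁).trans (le_max_left _ _)
  have hδ2 : -δ ≤ δ₂ := by
    have := (neg_abs_le δ₂)
    have := le_max_right |δ₁| |δ₂|
    linarith
  set T := Real.sqrt (2 * Real.log d) with hTdef
  have hT : 0 ≤ T := Real.sqrt_nonneg _
  have hd0 : (1 : ℝ) ≤ d := by exact_mod_cast hd
  -- joint Gaussianity
  have hZG : HasGaussianLaw Z P := by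
    refine ⟨isGaussian_of_map_eq_gaussianReal fun L => ?_⟩
    refine ⟨0, (∑ j, ∑ k, L (Pi.single j 1) * S j k * L (Pi.single k 1)).toNNReal, ?_⟩
    · rw [Measure.map_map L.continuous.measurable hZ]
      rw [← hGauss fun j => L (Pi.single j 1)]
      congr 1
      ext ω
      simp only [Function.comp]
      conv_lhs => rw [← LinearMap.sum_single_apply (fun _ => ℝ) (Z ω)]
      rw [map_sum]
      refine Finset.sum_congr rfl fun j _ => ?_
      have : (Pi.single j (Z ω j) : Fin d → ℝ) = Z ω j • Pi.single j 1 := by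
        rw [← Pi.single_smul]; simp
      rw [this, map_smul, smul_eq_mul, mul_comm]
  let s : Fin d → ℝ := fun j => √(S j j)
  have hSpos : ∀ j, 0 < S j j := fun j => lt_of_lt_of_le (by positivity) (hdiag j)
  have hs0 : ∀ j, 0 < s j := fun j => Real.sqrt_pos.2 (hSpos j)
  have hsσ : ∀ j, σ ≤ s j := fun j => Real.le_sqrt_of_sq_le (hdiag j)
  have hstd : ∀ (j : Fin d) (e : ℝ), e ^ 2 = 1 →
      P.map (fun ω => e / s j * Z ω j) = gaussianReal 0 1 := by
    intro j e he
    have h := hGauss (Pi.single j (e / s j))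
    simp only [Pi.single_apply, ite_mul, zero_mul, mul_ite, mul_zero, Finset.sum_ite_eq',
      Finset.mem_univ, if_true] at h
    rw [h]
    congr 1
    have hss : s j ^ 2 = S j j := Real.sq_sqrt (hSpos j).le
    have h1 : e / s j * S j j * (e / s j) = 1 := by
      have := (hs0 j).ne'
      rw [← hss]
      field_simp
      exact he
    rw [h1]
    simp
  -- trivial cases
  by_cases htriv : ∃ j, a j = ⊤ ∨ b j = ⊥
  · have hempty : {ω | ∀ j, a j ≤ (Z ω j : EReal) ∧ (Z ω j : EReal) ≤ b j} = ∅ := by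
      ext ω
      simp only [Set.mem_ofPred_eq, Set.mem_empty_iff_false, iff_false]
      intro h
      obtain ⟨j, hj | hj⟩ := htriv
      · have := (h j).1
        rw [hj] at this
        simp at this
      · have := (h j).2
        rw [hj] at this
        simp at this
    rw [hempty]
    have : 0 ≤ δ / σ * (T + 4) := by positivity
    have h2 : 0 ≤ (P {ω | ∀ j, a j + (δ₁ : EReal) ≤ (Z ω j : EReal) ∧
        (Z ω j : EReal) ≤ b j + (δ₂ : EReal)}).toReal := ENNReal.toReal_nonneg
    simp only [measure_empty, ENNReal.toReal_zero]
    linarith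
  push Not at htriv
  let ι := {p : Fin d × Bool // (p.2 = true → b p.1 ≠ ⊤) ∧ (p.2 = false → a p.1 ≠ ⊥)}
  let _ : Fintype ι := Fintype.ofFinite ι
  let e : Bool → ℝ := fun c => if c then 1 else -1
  let U : ι → Ω → ℝ := fun p ω => e p.1.2 / s p.1.1 * Z ω p.1.1
  let y : ι → ℝ := fun p =>
    ((if p.1.2 then (b p.1.1).toReal else -(a p.1.1).toReal) - δ) / s p.1.1
  have hcard : (Fintype.card ι : ℝ) ≤ 2 * d := by
    have h := Fintype.card_le_of_injective (Subtype.val : ι → Fin d × Bool)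
      Subtype.val_injective
    simp only [Fintype.card_prod, Fintype.card_fin, Fintype.card_bool] at h
    have : (Fintype.card ι : ℝ) ≤ ((d * 2 : ℕ) : ℝ) := by exact_mod_cast h
    push_cast at this
    linarith
  have hUm : ∀ p, Measurable (U p) := fun p =>
    ((measurable_pi_apply _).comp hZ).const_mul _
  have hUG : HasGaussianLaw (fun ω => (U · ω)) P :=
    hZG.map_fun (ContinuousLinearMap.pi fun p : ι => (e p.1.2 / s p.1.1) •
      (ContinuousLinearMap.proj p.1.1 : (Fin d → ℝ) →L[ℝ] ℝ))
  have hU1 : ∀ p, P.map (U p) = gaussianReal 0 1 := by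
    rintro ⟨⟨j, c⟩, hp⟩
    refine hstd j (e c) ?_
    cases c <;> simp [e]
  have hnaz := nazarov hUm hUG hU1 y (δ / σ) hT
  set A := {ω | ∀ j, a j ≤ (Z ω j : EReal) ∧ (Z ω j : EReal) ≤ b j}
  set B := {ω | ∀ j, a j + (δ₁ : EReal) ≤ (Z ω j : EReal) ∧
        (Z ω j : EReal) ≤ b j + (δ₂ : EReal)}
  set Abig := {ω | ∀ i, U i ω ≤ y i + δ / σ}
  set Bsml := {ω | ∀ i, U i ω ≤ y i}
  have hAA : A ⊆ Abig := by
    rintro ω hω ⟨⟨j, c⟩, hp⟩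
    have hsj := hs0 j
    have h3 : δ / s j ≤ δ / σ := by gcongr; exact hsσ j
    obtain ⟨h1, h2⟩ := hω j
    cases c
    · have hfin : ((a j).toReal : EReal) = a j :=
        EReal.coe_toReal (htriv j).1 (hp.2 rfl)
      rw [← hfin, EReal.coe_le_coe_iff] at h1
      simp only [U, y, e, Bool.false_eq_true, if_false]
      have h4 : (-1) / s j * Z ω j ≤ -(a j).toReal / s j := by
        rw [div_mul_eq_mul_div]; gcongr; linarith
      rw [sub_div]
      linarith
    · have hfin : ((b j).toReal : EReal) = b j :=
        EReal.coe_toReal (hp.1 rfl) (htriv j).2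
      rw [← hfin, EReal.coe_le_coe_iff] at h2
      simp only [U, y, e, if_true]
      have h4 : 1 / s j * Z ω j ≤ (b j).toReal / s j := by
        rw [div_mul_eq_mul_div]; gcongr; linarith
      rw [sub_div]
      linarith
  have hBB : Bsml ⊆ B := by
    intro ω hω j
    have hsj := hs0 j
    constructor
    · by_cases haj : a j = ⊥
      · simp [haj]
      · have h := hω ⟨⟨j, false⟩, by simp, fun _ => haj⟩
        simp only [U, y, e, Bool.false_eq_true, if_false] at h
        rw [div_mul_eq_mul_div, div_le_div_iff_of_pos_right hsj] at h
        have hfin : ((a j).toReal : EReal) = a j := EReal.coe_toReal (htriv j).1 haj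
        rw [← hfin, ← EReal.coe_add, EReal.coe_le_coe_iff]
        linarith
    · by_cases hbj : b j = ⊤
      · simp [hbj]
      · have h := hω ⟨⟨j, true⟩, fun _ => hbj, by simp⟩
        simp only [U, y, e, if_true] at h
        rw [div_mul_eq_mul_div, div_le_div_iff_of_pos_right hsj] at h
        have hfin : ((b j).toReal : EReal) = b j := EReal.coe_toReal hbj (htriv j).2
        rw [← hfin, ← EReal.coe_add, EReal.coe_le_coe_iff]
        linarith
  -- the density at `T`
  have hφT : d * gaussianPDFReal 0 1 T ≤ 1 / 2 := by
    have hlog : 0 ≤ Real.log d := Real.log_nonneg hd0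
    have hTsq : T ^ 2 = 2 * Real.log d := Real.sq_sqrt (by positivity)
    have hexp : rexp (-T ^ 2 / 2) = (d : ℝ)⁻¹ := by
      have : -T ^ 2 / 2 = -Real.log d := by rw [hTsq]; ring
      rw [this, Real.exp_neg, Real.exp_log (by linarith)]
    have h2 : (2 : ℝ) ≤ √(2 * π) := by
      apply Real.le_sqrt_of_sq_le
      nlinarith [Real.pi_gt_three]
    rw [phi_eq, hexp]
    have : (d : ℝ) * ((√(2 * π))⁻¹ * (d : ℝ)⁻¹) = (√(2 * π))⁻¹ := by field_simp
    rw [this, one_div]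
    gcongr
  have hreal : (P (Abig \ Bsml)).toReal ≤ δ / σ * (T + 4) := by
    have hne : ENNReal.ofReal (δ / σ) * (ENNReal.ofReal (T + 1) +
        Fintype.card ι * gaussianPDF 0 1 T) ≠ ⊤ := by
      refine ENNReal.mul_ne_top ENNReal.ofReal_ne_top (ENNReal.add_ne_top.2
        ⟨ENNReal.ofReal_ne_top, ENNReal.mul_ne_top (ENNReal.natCast_ne_top _) gaussianPDF_ne_top⟩)
    have h := ENNReal.toReal_mono hne hnaz
    refine h.trans ?_
    rw [ENNReal.toReal_mul, ENNReal.toReal_add ENNReal.ofReal_ne_top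
      (ENNReal.mul_ne_top (ENNReal.natCast_ne_top _) gaussianPDF_ne_top), ENNReal.toReal_mul,
      ENNReal.toReal_ofReal (by positivity), ENNReal.toReal_ofReal (by positivity),
      toReal_gaussianPDF, ENNReal.toReal_natCast]
    refine mul_le_mul_of_nonneg_left ?_ (by positivity)
    have := mul_le_mul_of_nonneg_right hcard (gaussianPDFReal_nonneg 0 1 T)
    linarith
  have hsub : A ⊆ B ∪ (Abig \ Bsml) := by
    intro ω hω
    by_cases h : ω ∈ Bsml
    · exact Or.inl (hBB h)
    · exact Or.inr ⟨hAA hω, h⟩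
  have hfinal : P.real A ≤ P.real B + P.real (Abig \ Bsml) :=
    (measureReal_mono hsub).trans (measureReal_union_le _ _)
  simp only [Measure.real] at hfinal
  linarith
end
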